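/- Let d, n ∈ ℕ, let ℓ : Fin n → ℝ^d → ℝ be loss functions each twice continuously differentiable, let w : Fin n → ℝ, fix an index j, and let θ : ℝ → ℝ^d be differentiable at 0 such that for all ε in a neighborhood of 0, ∑_i w i • ∇ℓ_i(θ(ε)) + ε • ∇ℓ_j(θ(ε)) = 0. Let H = ∑_i w i • Hess ℓ_i(θ(0)) and assume H is invertible. Let ℓ_test : ℝ^d → ℝ be differentiable at θ(0). Then the function ε ↦ ℓ_test(θ(ε)) is differentiable at 0 with derivative equal to −⟨∇ℓ_test(θ(0)), H⁻¹ (∇ℓ_j(θ(0)))⟩. -/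

import Mathlib

open scoped Topology RealInnerProductSpace

section GradientCalculus

variable {E : Type*} [NormedAddCommGroup E] [InnerProductSpace ℝ E] [CompleteSpace E]

theorem ContDiff.differentiable_gradient {f : E → ℝ} (hf : ContDiff ℝ 2 f) :
    Differentiable ℝ (gradient f) :=
  (InnerProductSpace.toDual ℝ E).symm.differentiable.comp
    ((hf.fderiv_right (m := 1) (by norm_num)).differentiable one_ne_zero)

theorem HasGradientAt.comp_hasDerivAt {f : E → ℝ} {f' : E} {γ : ℝ → E} {γ' : E} (t : ℝ)
    (hf : HasGradientAt f f' (γ t)) (hγ : HasDerivAt γ γ' t) :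
    HasDerivAt (fun s => f (γ s)) ⟪f', γ'⟫ t := by
  have h := hf.hasFDerivAt.comp_hasDerivAt t hγ
  rwa [InnerProductSpace.toDual_apply_apply] at h

/-- Implicit differentiation of `∑ i, w i • G i (θ ε) + ε • F (θ ε) = 0` at `ε = 0`. -/
theorem sum_smul_fderiv_apply_deriv_eq_neg {ι V W : Type*} [Fintype ι]
    [NormedAddCommGroup V] [NormedSpace ℝ V] [NormedAddCommGroup W] [NormedSpace ℝ W]
    {G : ι → V → W} {F : V → W} (w : ι → ℝ) {θ : ℝ → V}
    (hG : ∀ i, DifferentiableAt ℝ (G i) (θ 0)) (hF : DifferentiableAt ℝ F (θ 0))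
    (hθ : DifferentiableAt ℝ θ 0)
    (h : ∀ᶠ ε in 𝓝 (0 : ℝ), ∑ i, w i • G i (θ ε) + ε • F (θ ε) = 0) :
    (∑ i, w i • fderiv ℝ (G i) (θ 0)) (deriv θ 0) = -F (θ 0) := by
  have hsum : HasDerivAt (fun ε => ∑ i, w i • G i (θ ε))
      (∑ i, w i • fderiv ℝ (G i) (θ 0) (deriv θ 0)) 0 :=
    HasDerivAt.fun_sum fun i _ =>
      ((hG i).hasFDerivAt.comp_hasDerivAt 0 hθ.hasDerivAt).const_smul (w i)
  have hpert := (hasDerivAt_id (0 : ℝ)).smul (hF.hasFDerivAt.comp_hasDerivAt 0 hθ.hasDerivAt)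
  have hzero := (hasDerivAt_const (0 : ℝ) (0 : W)).congr_of_eventuallyEq h
  have huniq := (hsum.add hpert).unique hzero
  rw [eq_neg_iff_add_eq_zero]
  simpa [sum_apply] using huniq

end GradientCalculus

/-- Definition 1 combined with Equation (3): under the influence-function setup, the map
`ε ↦ ℓ_test(θ(ε))` is differentiable at `0` with derivative
`−⟨∇ℓ_test(θ(0)), H⁻¹ ∇ℓ_j(θ(0))⟩`, where `H = ∑ i, w i • Hess ℓ_i(θ(0))` is the (invertible)
Hessian of the weighted objective at `θ(0)`, with inverse `Hinv`. -/
theorem stmt_8 (d n : ℕ) (ℓ : Fin n → EuclideanSpace ℝ (Fin d) → ℝ)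
    (hℓ : ∀ i, ContDiff ℝ 2 (ℓ i)) (w : Fin n → ℝ) (j : Fin n)
    (θ : ℝ → EuclideanSpace ℝ (Fin d)) (hθ : DifferentiableAt ℝ θ 0)
    (hstat : ∀ᶠ ε in 𝓝 (0 : ℝ),
      ∑ i, w i • gradient (ℓ i) (θ ε) + ε • gradient (ℓ j) (θ ε) = 0)
    (H Hinv : EuclideanSpace ℝ (Fin d) →L[ℝ] EuclideanSpace ℝ (Fin d))
    (hH : H = ∑ i, w i • fderiv ℝ (fun x => gradient (ℓ i) x) (θ 0))
    (hinv₁ : Hinv.comp H = ContinuousLinearMap.id ℝ (EuclideanSpace ℝ (Fin d)))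
    (hinv₂ : H.comp Hinv = ContinuousLinearMap.id ℝ (EuclideanSpace ℝ (Fin d)))
    (ℓtest : EuclideanSpace ℝ (Fin d) → ℝ) (hℓtest : DifferentiableAt ℝ ℓtest (θ 0)) :
    HasDerivAt (fun ε => ℓtest (θ ε))
      (-⟪gradient ℓtest (θ 0), Hinv (gradient (ℓ j) (θ 0))⟫) 0 := by
  have hHθ : H (deriv θ 0) = -gradient (ℓ j) (θ 0) := by
    rw [hH]
    exact sum_smul_fderiv_apply_deriv_eq_neg w
      (fun i => (hℓ i).differentiable_gradient (θ 0))
      ((hℓ j).differentiable_gradient (θ 0)) hθ hstat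
  have hderiv : deriv θ 0 = -Hinv (gradient (ℓ j) (θ 0)) := by
    rw [← map_neg, ← hHθ, ← ContinuousLinearMap.comp_apply, hinv₁,
      ContinuousLinearMap.id_apply]
  rw [← inner_neg_right, ← hderiv]
  exact hℓtest.hasGradientAt.comp_hasDerivAt 0 hθ.hasDerivAt
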